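/- arXiv:2405.03444 — 3 statements merged into one kernel-verified Lean document; each statement's English description precedes it below -/
import Mathlib

section
/- For every integer m ≥ 2, let W be the complex-valued function defined on points z ∈ ℂ^m with all coordinates nonzero by W(z) = 1/z_m + Σ_{j=2}^{m} z_j/z_{j−1} + 2 z₂ + z₁ z₂. Then the point p ∈ ℂ^m given by p₁ = 1 and p_k = 4^{(k−1−m)/m} for 2 ≤ k ≤ m (where 4^{(k−1−m)/m} denotes the positive real power of 4) is a critical point of W: all m partial derivatives of W vanish at p. -/
open Finset in
/-- The derivative of the quadric superpotential in the `i`-th coordinate direction, with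
coordinates extended to a sequence. -/
theorem hasDerivAt_quadric_superpotential (m : ℕ) (q : ℕ → ℂ) (hq : ∀ k, q k ≠ 0)
    (i : ℕ) :
    HasDerivAt (fun w : ℂ => (Function.update q i w (m - 1))⁻¹
        + (∑ j ∈ range (m - 1), Function.update q i w (j + 1) * (Function.update q i w j)⁻¹)
        + 2 * Function.update q i w 1 + Function.update q i w 0 * Function.update q i w 1)
      (-(if m - 1 = i then 1 else 0) / q (m - 1) ^ 2
        + (∑ j ∈ range (m - 1), ((if j + 1 = i then 1 else 0) * (q j)⁻¹
          + q (j + 1) * (-(if j = i then 1 else 0) / q j ^ 2)))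
        + 2 * (if 1 = i then 1 else 0)
        + ((if 0 = i then 1 else 0) * q 1 + q 0 * (if 1 = i then 1 else 0))) (q i) := by
  have coord (k : ℕ) :
      HasDerivAt (fun w : ℂ => Function.update q i w k) (if k = i then 1 else 0) (q i) := by
    split_ifs with h
    · subst h
      simpa using hasDerivAt_id' (q k)
    · simpa [Function.update_of_ne h] using hasDerivAt_const (q i) (q k)
  have inv (k : ℕ) : HasDerivAt (fun w : ℂ => (Function.update q i w k)⁻¹)
      (-(if k = i then 1 else 0) / q k ^ 2) (q i) := by
    simpa using (coord k).fun_inv (by simpa using hq k)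
  have hsum := HasDerivAt.fun_sum (u := range (m - 1))
    fun j _ => (coord (j + 1)).fun_mul (inv j)
  have h := (((inv (m - 1)).fun_add hsum).fun_add ((coord 1).const_mul 2)).fun_add
    ((coord 0).fun_mul (coord 1))
  simpa only [Function.update_eq_self] using h

open Finset in
/-- The partial derivatives of the quadric superpotential vanish at a point satisfying the
critical point recursion. -/
theorem quadric_superpotential_partial_eq_zero (m : ℕ) (hm : 2 ≤ m) (q : ℕ → ℂ)
    (hq : ∀ k, q k ≠ 0) (h0 : q 0 = 1) (h2 : q 2 = 4 * q 1 ^ 2)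
    (hrec : ∀ k, 1 ≤ k → q (k + 2) * q k = q (k + 1) ^ 2) (hlast : q m = 1)
    (i : ℕ) (hi : i < m) :
    -(if m - 1 = i then 1 else 0) / q (m - 1) ^ 2
        + (∑ j ∈ range (m - 1), ((if j + 1 = i then 1 else 0) * (q j)⁻¹
          + q (j + 1) * (-(if j = i then 1 else 0) / q j ^ 2)))
        + 2 * (if 1 = i then 1 else 0)
        + ((if 0 = i then 1 else 0) * q 1 + q 0 * (if 1 = i then 1 else 0)) = 0 := by
  rw [sum_add_distrib]
  obtain _ | k := i
  · have hm1 : m - 1 ≠ 0 := by omega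
    simp [neg_div, ite_div, hm1, h0, Nat.pos_of_ne_zero hm1]
  · have hk : k < m - 1 := by omega
    have hnext : -(if m - 1 = k + 1 then 1 else 0) / q (m - 1) ^ 2
        + ∑ j ∈ range (m - 1), q (j + 1) * (-(if j = k + 1 then 1 else 0) / q j ^ 2)
        = -(q (k + 2) / q (k + 1) ^ 2) := by
      by_cases h : m - 1 = k + 1
      · obtain rfl : m = k + 2 := by omega
        simp [neg_div, ite_div, hlast]
      · have : k + 1 < m - 1 := by omega
        simp [h, this, div_eq_mul_inv]
    have hprev : ∑ j ∈ range (m - 1), (if j + 1 = k + 1 then 1 else 0) * (q j)⁻¹ = (q k)⁻¹ := by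
      simp [hk]
    rw [hprev]
    have hk1 := hq (k + 1)
    obtain rfl | hk0 := Nat.eq_zero_or_pos k
    · have h1 := hq 1
      have : q 2 / q 1 ^ 2 = 4 := by rw [h2]; field_simp
      simp only [zero_add] at hnext ⊢
      rw [this] at hnext
      simp only [h0, if_true, zero_ne_one, if_false]
      linear_combination hnext
    · have hne : ¬ 1 = k + 1 := by omega
      have : q (k + 2) / q (k + 1) ^ 2 = (q k)⁻¹ := by
        rw [← hrec k hk0]
        have := hq k
        have := hq (k + 2)
        field_simp
      rw [this] at hnext
      simp only [hne, if_false, (Nat.succ_ne_zero k).symm]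
      linear_combination hnext


/-- The point `p` with `p₁ = 1` and `p_k = 4^((k-1-m)/m)` for `2 ≤ k ≤ m` is a critical
point of the Gelfand–Zeitlin superpotential
`W(z) = 1/z_m + ∑_{j=2}^m z_j/z_{j-1} + 2 z₂ + z₁ z₂` of the monotone torus in the
quadric `Q^m`: all `m` partial derivatives of `W` vanish at `p`.
(Coordinates are indexed by `Fin m`, so the `1`-based coordinate `z_k` is `z ⟨k-1⟩`.) -/
theorem GZ_superpotential_critical_point (m : ℕ) (hm : 2 ≤ m)
    (W : (Fin m → ℂ) → ℂ)
    (hW : ∀ z : Fin m → ℂ, (∀ i, z i ≠ 0) →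
      W z = (z ⟨m - 1, by omega⟩)⁻¹
        + (∑ j : Fin (m - 1),
            z ⟨(j : ℕ) + 1, by have := j.isLt; omega⟩ * (z ⟨(j : ℕ), by have := j.isLt; omega⟩)⁻¹)
        + 2 * z ⟨1, by omega⟩ + z ⟨0, by omega⟩ * z ⟨1, by omega⟩) :
    let p : Fin m → ℂ := fun i =>
      if (i : ℕ) = 0 then 1
      else ((4 : ℝ) ^ (((((i : ℕ) : ℝ) + 1) - 1 - (m : ℝ)) / (m : ℝ)) : ℝ)
    ∀ i : Fin m, deriv (fun w : ℂ => W (Function.update p i w)) (p i) = 0 := by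
  intro p i
  let q : ℕ → ℂ := fun k =>
    if k = 0 then 1 else (((4 : ℝ) ^ (((k : ℝ) + 1 - 1 - (m : ℝ)) / (m : ℝ)) : ℝ) : ℂ)
  have hm0 : (m : ℝ) ≠ 0 := by positivity
  have hq (k : ℕ) : q k ≠ 0 := by
    by_cases hk : k = 0
    · simp [q, hk]
    · simp only [q, hk, if_false]
      exact_mod_cast (Real.rpow_pos_of_pos (by norm_num) _).ne'
  have h2 : q 2 = 4 * q 1 ^ 2 := by
    simp only [q, OfNat.ofNat_ne_zero, one_ne_zero, if_false]
    have h4 : (4 : ℂ) = (((4 : ℝ) ^ (1 : ℝ) : ℝ) : ℂ) := by simp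
    rw [h4, ← Complex.ofReal_pow, ← Complex.ofReal_mul, ← Real.rpow_mul_natCast (by norm_num),
      ← Real.rpow_add (by norm_num)]
    congr 2
    push_cast
    field_simp
    ring
  have hrec (k : ℕ) (hk : 1 ≤ k) : q (k + 2) * q k = q (k + 1) ^ 2 := by
    have hk0 : k ≠ 0 := by omega
    simp only [q, hk0, Nat.add_eq_zero_iff, OfNat.ofNat_ne_zero, one_ne_zero, and_false, if_false]
    rw [← Complex.ofReal_mul, ← Complex.ofReal_pow, ← Real.rpow_mul_natCast (by norm_num),
      ← Real.rpow_add (by norm_num)]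
    congr 2
    push_cast
    field_simp
    ring
  have hlast : q m = 1 := by
    have : m ≠ 0 := by omega
    simp [q, this]
  have hp (k : Fin m) : p k = q k := rfl
  have hupd (w : ℂ) (k : Fin m) : Function.update p i w k = Function.update q i w k := by
    simp only [Function.update_apply, Fin.ext_iff, hp]
  have hderiv := hasDerivAt_quadric_superpotential m q hq i
  rw [quadric_superpotential_partial_eq_zero m hm q hq (by simp [q]) h2 hrec hlast i i.isLt]
    at hderiv
  refine (hderiv.congr_of_eventuallyEq ?_).deriv
  filter_upwards [isOpen_ne.mem_nhds (hq i)] with w hw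
  rw [hW]
  · simp only [hupd, ← Fin.sum_univ_eq_sum_range
      fun j => Function.update q i w (j + 1) * (Function.update q i w j)⁻¹]
  · intro k
    rw [Function.update_apply]
    split_ifs
    exacts [hw, hq k]
end

section
/- For every integer m ≥ 2, the function W defined on points z ∈ ℂ^m with all coordinates nonzero by W(z) = 1/z_m + Σ_{j=2}^{m} z_j/z_{j−1} + 2 z₂ + z₁ z₂ has a nondegenerate critical point: there exists a point p with all coordinates nonzero at which all m partial derivatives of W vanish and the Hessian matrix of W is invertible. -/
open Filter Topology Matrix ComplexOrder

/-- `f` has logarithmic partial derivatives `e` on the torus `(ℂ*)^ι`, as the Laurent monomials with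
exponent vector `e` do. -/
def HasLogPartials {ι : Type*} [DecidableEq ι] (f : (ι → ℂ) → ℂ) (e : ι → ℤ) : Prop :=
  ∀ z : ι → ℂ, (∀ i, z i ≠ 0) → ∀ i,
    HasDerivAt (fun w : ℂ => f (Function.update z i w)) (e i * f z / z i) (z i)

namespace HasLogPartials

variable {ι : Type*} [DecidableEq ι] {f g : (ι → ℂ) → ℂ} {e e' : ι → ℤ}

theorem coord (k : ι) : HasLogPartials (fun z => z k) (Pi.single k 1) := by
  intro z hz i
  have h := hasDerivAt_pi.1 (hasDerivAt_update z i (z i)) k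
  refine h.congr_deriv ?_
  by_cases hik : k = i
  · subst hik
    simp [hz k]
  · simp [hik, Ne.symm hik]

theorem mul (hf : HasLogPartials f e) (hg : HasLogPartials g e') :
    HasLogPartials (fun z => f z * g z) (e + e') := by
  intro z hz i
  refine ((hf z hz i).mul (hg z hz i)).congr_deriv ?_
  simp only [Function.update_eq_self, Pi.add_apply, Int.cast_add]
  ring

theorem inv (hf : HasLogPartials f e) (h0 : ∀ z, (∀ i, z i ≠ 0) → f z ≠ 0) :
    HasLogPartials (fun z => (f z)⁻¹) (-e) := by
  intro z hz i
  have hfz := h0 z hz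
  refine ((hf z hz i).inv (by simpa using hfz)).congr_deriv ?_
  have := hz i
  simp only [Function.update_eq_self, Pi.neg_apply, Int.cast_neg]
  field_simp

end HasLogPartials

theorem eventually_update_ne_zero {ι : Type*} [DecidableEq ι] {z : ι → ℂ} (hz : ∀ i, z i ≠ 0)
    (i : ι) : ∀ᶠ w in 𝓝 (z i), ∀ k, Function.update z i w k ≠ 0 := by
  filter_upwards [eventually_ne_nhds (hz i)] with w hw k
  by_cases hk : k = i
  · subst hk
    simpa using hw
  · simpa [hk] using hz k

section LaurentPolynomial

variable {ι α : Type*} [DecidableEq ι] [Fintype α] {W : (ι → ℂ) → ℂ} {c : α → ℂ}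
  {f : α → (ι → ℂ) → ℂ} {e : α → ι → ℤ}

theorem partial_eq_of_hasLogPartials (hf : ∀ a, HasLogPartials (f a) (e a))
    (hW : ∀ z, (∀ i, z i ≠ 0) → W z = ∑ a, c a * f a z) {z : ι → ℂ} (hz : ∀ i, z i ≠ 0) (i : ι) :
    deriv (fun w : ℂ => W (Function.update z i w)) (z i)
      = (∑ a, c a * e a i * f a z) * (z i)⁻¹ := by
  have h : HasDerivAt (fun w : ℂ => ∑ a, c a * f a (Function.update z i w))
      (∑ a, c a * (e a i * f a z / z i)) (z i) :=
    HasDerivAt.fun_sum fun a _ => (hf a z hz i).const_mul (c a)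
  have h' := h.congr_of_eventuallyEq (f₁ := fun w : ℂ => W (Function.update z i w))
    ((eventually_update_ne_zero hz i).mono fun w hw => hW _ hw)
  rw [h'.deriv, Finset.sum_mul]
  exact Finset.sum_congr rfl fun a _ => by ring

/-- At a critical point, the Hessian in the coordinates `z` is the Hessian in the coordinates
`log z` up to the scaling by the coordinates. -/
theorem hessian_eq_of_hasLogPartials (hf : ∀ a, HasLogPartials (f a) (e a))
    (hW : ∀ z, (∀ i, z i ≠ 0) → W z = ∑ a, c a * f a z) {p : ι → ℂ} (hp : ∀ i, p i ≠ 0)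
    (hcrit : ∀ i, ∑ a, c a * e a i * f a p = 0) (i j : ι) :
    p i * deriv (fun w : ℂ => deriv (fun v : ℂ => W (Function.update (Function.update p j w) i v))
        (Function.update p j w i)) (p j) * p j
      = ∑ a, e a i * (c a * f a p) * e a j := by
  have h₁ : HasDerivAt (fun w : ℂ => ∑ a, c a * e a i * f a (Function.update p j w))
      (∑ a, c a * e a i * (e a j * f a p / p j)) (p j) :=
    HasDerivAt.fun_sum fun a _ => (hf a p hp j).const_mul _
  have h₂ : DifferentiableAt ℂ (fun w : ℂ => (Function.update p j w i)⁻¹) (p j) :=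
    (hasDerivAt_pi.1 (hasDerivAt_update p j (p j)) i).differentiableAt.inv (by simpa using hp i)
  have h := (h₁.mul h₂.hasDerivAt).congr_of_eventuallyEq
    ((eventually_update_ne_zero hp j).mono fun w hw => partial_eq_of_hasLogPartials hf hW hw i)
  rw [h.deriv]
  simp only [Function.update_eq_self, hcrit, zero_mul, add_zero, Finset.mul_sum, Finset.sum_mul]
  refine Finset.sum_congr rfl fun a _ => ?_
  have := hp i
  have := hp j
  field_simp

/-- A critical point at which all monomials take positive values is nondegenerate as soon as the
exponent vectors span. -/
theorem isUnit_det_hessian_of_pos [Fintype ι] (hf : ∀ a, HasLogPartials (f a) (e a))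
    (hW : ∀ z, (∀ i, z i ≠ 0) → W z = ∑ a, c a * f a z) {p : ι → ℂ} (hp : ∀ i, p i ≠ 0)
    (hcrit : ∀ i, ∑ a, c a * e a i * f a p = 0) (hpos : ∀ a, 0 < c a * f a p)
    (hspan : ∀ y : ι → ℂ, (∀ a, ∑ i, (e a i : ℂ) * y i = 0) → y = 0) :
    IsUnit (Matrix.of fun i j => deriv (fun w : ℂ =>
      deriv (fun v : ℂ => W (Function.update (Function.update p j w) i v))
        (Function.update p j w i)) (p j)).det := by
  classical
  set H : Matrix ι ι ℂ := Matrix.of fun i j => deriv (fun w : ℂ =>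
      deriv (fun v : ℂ => W (Function.update (Function.update p j w) i v))
        (Function.update p j w i)) (p j)
  let E : Matrix α ι ℂ := Matrix.of fun a i => (e a i : ℂ)
  have hE : Function.Injective E.mulVec := by
    refine (injective_iff_map_eq_zero E.mulVecLin).2 fun y hy => hspan y fun a => ?_
    exact congrFun hy a
  have hpd := (Matrix.PosDef.diagonal hpos).conjTranspose_mul_mul_same hE
  have hEH : diagonal p * H * diagonal p = Eᴴ * diagonal (fun a => c a * f a p) * E := by
    ext i j
    rw [mul_diagonal, diagonal_mul, Matrix.mul_apply]
    simp only [mul_diagonal, conjTranspose_apply, E, of_apply, star_intCast]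
    exact hessian_eq_of_hasLogPartials hf hW hp hcrit i j
  rw [← hEH] at hpd
  have hdet := hpd.det_pos.ne'
  rw [det_mul, det_mul] at hdet
  exact (right_ne_zero_of_mul (left_ne_zero_of_mul hdet)).isUnit

end LaurentPolynomial


/-- The Gelfand–Zeitlin superpotential
`W(z) = 1/z_m + ∑_{j=2}^m z_j/z_{j-1} + 2 z₂ + z₁ z₂` on `(ℂ*)^m` (for `m ≥ 2`) has a
nondegenerate critical point: a point `p` with all coordinates nonzero, at which all `m`
partial derivatives of `W` vanish and the Hessian matrix of `W` is invertible.
(Coordinates are indexed by `Fin m`, so the `1`-based coordinate `z_k` is `z ⟨k-1⟩`.) -/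
theorem GZ_superpotential_nondegenerate_critical_point (m : ℕ) (hm : 2 ≤ m)
    (W : (Fin m → ℂ) → ℂ)
    (hW : ∀ z : Fin m → ℂ, (∀ i, z i ≠ 0) →
      W z = (z ⟨m - 1, by omega⟩)⁻¹
        + (∑ j : Fin (m - 1),
            z ⟨(j : ℕ) + 1, by have := j.isLt; omega⟩ * (z ⟨(j : ℕ), by have := j.isLt; omega⟩)⁻¹)
        + 2 * z ⟨1, by omega⟩ + z ⟨0, by omega⟩ * z ⟨1, by omega⟩) :
    -- the `i`-th partial derivative of `W` at a point `z`
    let pd : (Fin m → ℂ) → Fin m → ℂ :=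
      fun z i => deriv (fun w : ℂ => W (Function.update z i w)) (z i)
    -- the Hessian matrix of `W` at a point `p`, with `(i,j)` entry `∂²W/∂zᵢ∂zⱼ (p)`
    let hess : (Fin m → ℂ) → Matrix (Fin m) (Fin m) ℂ :=
      fun p => Matrix.of fun i j => deriv (fun w : ℂ => pd (Function.update p j w) i) (p j)
    ∃ p : Fin m → ℂ, (∀ i, p i ≠ 0) ∧ (∀ i, pd p i = 0) ∧ IsUnit (hess p).det := by
  intro pd hess
  obtain ⟨n, rfl⟩ : ∃ n, m = n + 2 := ⟨m - 2, by omega⟩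
  let f : Fin (n + 1) ⊕ Fin 3 → (Fin (n + 2) → ℂ) → ℂ :=
    Sum.elim (fun j z => z j.succ * (z j.castSucc)⁻¹)
      ![fun z => (z (Fin.last (n + 1)))⁻¹, fun z => z 1, fun z => z 0 * z 1]
  let c : Fin (n + 1) ⊕ Fin 3 → ℂ := Sum.elim (fun _ => 1) ![1, 2, 1]
  let e : Fin (n + 1) ⊕ Fin 3 → Fin (n + 2) → ℤ :=
    Sum.elim (fun j => Pi.single j.succ 1 + -Pi.single j.castSucc 1)
      ![-Pi.single (Fin.last (n + 1)) 1, Pi.single 1 1, Pi.single 0 1 + Pi.single 1 1]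
  have hf : ∀ a, HasLogPartials (f a) (e a) := by
    have hinv (k : Fin (n + 2)) : HasLogPartials (fun z => (z k)⁻¹) (-Pi.single k 1) :=
      (HasLogPartials.coord k).inv fun z hz => hz k
    rintro (j | a)
    · exact (HasLogPartials.coord _).mul (hinv _)
    · fin_cases a
      · exact hinv _
      · exact HasLogPartials.coord 1
      · exact (HasLogPartials.coord 0).mul (HasLogPartials.coord 1)
  have hW' : ∀ z, (∀ i, z i ≠ 0) → W z = ∑ a, c a * f a z := by
    intro z hz
    rw [hW z hz, Fintype.sum_sum_type, Fin.sum_univ_three]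
    have hsum : (∑ j : Fin (n + 2 - 1), z ⟨(j : ℕ) + 1, by omega⟩ * (z ⟨(j : ℕ), by omega⟩)⁻¹)
        = ∑ j : Fin (n + 1), c (Sum.inl j) * f (Sum.inl j) z :=
      Finset.sum_congr rfl fun j _ => (one_mul _).symm
    rw [hsum]
    change (z (Fin.last (n + 1)))⁻¹ + _ + 2 * z 1 + z 0 * z 1
      = _ + (1 * (z (Fin.last (n + 1)))⁻¹ + 2 * z 1 + 1 * (z 0 * z 1))
    ring
  -- the critical point is `(1, r/4, r²/4, …)` with `r ^ m = 4`
  obtain ⟨r, hr, hrm⟩ : ∃ r : ℝ, 0 < r ∧ r ^ (n + 2) = 4 :=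
    ⟨4 ^ ((n + 2 : ℕ) : ℝ)⁻¹, by positivity,
      Real.rpow_inv_natCast_pow (by norm_num) (by omega)⟩
  have hrC : (r : ℂ) ≠ 0 := by exact_mod_cast hr.ne'
  have hrmC : (r : ℂ) ^ (n + 2) = 4 := by exact_mod_cast hrm
  let p : Fin (n + 2) → ℂ := Fin.cons 1 fun k : Fin (n + 1) => (r : ℂ) ^ ((k : ℕ) + 1) / 4
  have hp0 : p 0 = 1 := rfl
  have hps (k : Fin (n + 1)) : p k.succ = (r : ℂ) ^ ((k : ℕ) + 1) / 4 := rfl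
  have hp1 : p 1 = r / 4 := by simpa using hps 0
  have hp : ∀ i, p i ≠ 0 := by
    intro i
    refine Fin.cases (by simp [hp0]) (fun k => ?_) i
    rw [hps]
    positivity
  have hlast : (p (Fin.last (n + 1)))⁻¹ = r := by
    rw [← Fin.succ_last, hps, Fin.val_last]
    field_simp
    rw [← hrmC]
    ring
  have hratio (j : Fin (n + 1)) :
      p j.succ * (p j.castSucc)⁻¹ = r - if j = 0 then 3 * (r : ℂ) / 4 else 0 := by
    rw [hps]
    refine Fin.cases ?_ (fun k => ?_) j
    · simp [hp0]
      ring
    · rw [Fin.castSucc_succ, hps]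
      simp only [Fin.val_succ, Fin.val_castSucc, Fin.succ_ne_zero, if_false]
      field_simp
      ring
  have hcrit : ∀ i, ∑ a, c a * e a i * f a p = 0 := by
    intro i
    rw [Fintype.sum_sum_type, Fin.sum_univ_three]
    let s (k : Fin (n + 2)) : ℂ := ((Pi.single k 1 : Fin (n + 2) → ℤ) i : ℂ)
    have htel : ∑ j : Fin (n + 1), (s j.succ - s j.castSucc) = s (Fin.last (n + 1)) - s 0 := by
      rw [Finset.sum_sub_distrib]
      linear_combination Fin.sum_univ_castSucc s - Fin.sum_univ_succ s
    have hinl : ∑ j : Fin (n + 1), c (Sum.inl j) * e (Sum.inl j) i * f (Sum.inl j) p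
        = r * (s (Fin.last (n + 1)) - s 0) - 3 * r / 4 * (s 1 - s 0) := by
      have hterm (j : Fin (n + 1)) : c (Sum.inl j) * e (Sum.inl j) i * f (Sum.inl j) p
          = r * (s j.succ - s j.castSucc)
            - if j = 0 then 3 * r / 4 * (s j.succ - s j.castSucc) else 0 := by
        have : c (Sum.inl j) * e (Sum.inl j) i * f (Sum.inl j) p
            = (s j.succ - s j.castSucc) * (p j.succ * (p j.castSucc)⁻¹) := by
          simp [c, e, f, s, sub_eq_add_neg]
        rw [this, hratio]
        split_ifs <;> ring
      simp only [hterm, Finset.sum_sub_distrib, ← Finset.mul_sum, Finset.sum_ite_eq',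
        Finset.mem_univ, if_true]
      rw [← Finset.sum_sub_distrib, htel]
      rfl
    have h0 : c (Sum.inr 0) * e (Sum.inr 0) i * f (Sum.inr 0) p = -s (Fin.last (n + 1)) * r := by
      simp [c, e, f, s, hlast]
    have h1 : c (Sum.inr 1) * e (Sum.inr 1) i * f (Sum.inr 1) p = 2 * s 1 * (r / 4) := by
      simp [c, e, f, s, hp1]
    have h2 : c (Sum.inr 2) * e (Sum.inr 2) i * f (Sum.inr 2) p = (s 0 + s 1) * (r / 4) := by
      simp [c, e, f, s, hp0, hp1]
    rw [hinl, h0, h1, h2]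
    ring
  have hrpos : (0 : ℂ) < r := by exact_mod_cast hr
  have hpos : ∀ a, 0 < c a * f a p := by
    rintro (j | a)
    · change 0 < 1 * (p j.succ * (p j.castSucc)⁻¹)
      rw [hratio, one_mul]
      split_ifs
      · have : (r : ℂ) - 3 * r / 4 = ((r / 4 : ℝ) : ℂ) := by
          push_cast
          ring
        rw [this]
        exact_mod_cast (by positivity : 0 < r / 4)
      · simpa using hr
    · have hr4 : (0 : ℂ) < r / 4 := by exact_mod_cast (by positivity : 0 < r / 4)
      fin_cases a
      · simpa [c, f, hlast] using hr
      · simpa [c, f, hp1] using hr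
      · simpa [c, f, hp0, hp1] using hr
  have hspan : ∀ y : Fin (n + 2) → ℂ, (∀ a, ∑ i, (e a i : ℂ) * y i = 0) → y = 0 := by
    intro y hy
    have hsingle (k : Fin (n + 2)) :
        ∑ i, ((Pi.single k 1 : Fin (n + 2) → ℤ) i : ℂ) * y i = y k := by
      simp [Pi.single_apply]
    have hend : y (Fin.last (n + 1)) = 0 := by
      simpa [e, hsingle] using hy (Sum.inr 0)
    have hstep (j : Fin (n + 1)) : y j.succ = y j.castSucc := by
      have := hy (Sum.inl j)
      simp only [e, Sum.elim_inl, Pi.add_apply, Pi.neg_apply, Int.cast_add, Int.cast_neg, add_mul,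
        neg_mul, Finset.sum_add_distrib, Finset.sum_neg_distrib, hsingle] at this
      linear_combination this
    funext i
    exact Fin.reverseInduction hend (fun j hj => (hstep j).symm.trans hj) i
  refine ⟨p, hp, fun i => ?_, isUnit_det_hessian_of_pos hf hW' hp hcrit hpos hspan⟩
  simp only [pd]
  rw [partial_eq_of_hasLogPartials hf hW' hp, hcrit, zero_mul]
end

section
/- Fix an integer n ≥ 1 and let Λ = HahnSeries ℝ ℂ be the field of Hahn series over ℂ with real exponents, and let T ∈ Λ be the monomial with exponent 1 and coefficient 1. Then the quotient ring Λ[X]/(X^{n+1} − T) is isomorphic as a ring to the product of n+1 copies of Λ, i.e. to Fin (n+1) → Λ. -/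
open Polynomial

/-- If `X ^ m - a` has the root `s ≠ 0` in a field with a primitive `m`-th root of unity, then it
splits into distinct linear factors, so the quotient by it is a product of `m` copies of the
field. -/
theorem AdjoinRoot.nonempty_pow_sub_C_ringEquiv_pi {K : Type*} [Field K] {ζ s a : K} {m : ℕ}
    (hm : 0 < m) (hζ : IsPrimitiveRoot ζ m) (hs : s ≠ 0) (ha : s ^ m = a) :
    Nonempty (AdjoinRoot (X ^ m - C a : K[X]) ≃+* (Fin m → K)) := by
  have hinj : Function.Injective fun i : Fin m => ζ ^ (i : ℕ) * s := fun i j hij =>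
    Fin.ext (hζ.pow_inj i.2 j.2 (mul_right_cancel₀ hs hij))
  have hcop := pairwise_coprime_X_sub_C hinj
  have hprod : ∏ i : Fin m, (X - C (ζ ^ (i : ℕ) * s)) = X ^ m - C a := by
    rw [X_pow_sub_C_eq_prod hζ hm ha, Finset.prod_range]
  have hspan : Ideal.span {(X ^ m - C a : K[X])} =
      ⨅ i : Fin m, Ideal.span {X - C (ζ ^ (i : ℕ) * s)} := by
    rw [Ideal.iInf_span_singleton hcop, hprod]
  exact ⟨(Ideal.quotEquivOfEq hspan).trans <|
    (Ideal.quotientInfRingEquivPiQuotient _ fun i j hij =>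
      (Ideal.isCoprime_span_singleton_iff _ _).mpr (hcop hij)).trans <|
    RingEquiv.piCongrRight fun i => (quotientSpanXSubCAlgEquiv (ζ ^ (i : ℕ) * s)).toRingEquiv⟩

/-- Over the field `Λ = HahnSeries ℝ ℂ` of Hahn series with real exponents (which contains
the universal Novikov field), the quotient ring `Λ[X]/(X^(n+1) - T)` (i.e. `AdjoinRoot` of
`X^(n+1) - T`, where `T` is the monomial of exponent `1` and coefficient `1`) is isomorphic
as a ring to the product of `n + 1` copies of `Λ`. -/
theorem adjoinRoot_pow_sub_T_iso_pi (n : ℕ) (hn : 1 ≤ n) :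
    Nonempty
      ((AdjoinRoot (X ^ (n + 1) - C (HahnSeries.single (1 : ℝ) (1 : ℂ)) :
          Polynomial (HahnSeries ℝ ℂ))) ≃+*
        (Fin (n + 1) → HahnSeries ℝ ℂ)) := by
  refine AdjoinRoot.nonempty_pow_sub_C_ringEquiv_pi (s := HahnSeries.single (1 / ((n : ℝ) + 1)) 1)
    n.succ_pos ((Complex.isPrimitiveRoot_exp (n + 1) n.succ_ne_zero).map_of_injective
      (f := (HahnSeries.C : ℂ →+* HahnSeries ℝ ℂ)) HahnSeries.C_injective)
    (HahnSeries.single_ne_zero one_ne_zero) ?_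
  have h : (n : ℝ) + 1 ≠ 0 := by positivity
  rw [HahnSeries.single_pow, one_pow, nsmul_eq_mul, Nat.cast_succ, mul_one_div_cancel h]
end
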